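/- (Convergence of hybrid Algorithm 8.) Under the Problem setup, let {(x_k, y_k, λ_k, u_k, v_k)}_{k≥1} satisfy Scheme D, and let (x*, y*, λ*) ∈ Ω. Assume α ≤ 1/L_{f2} and {t_k}_{k≥1} ⊆ [1, +∞) is nondecreasing with t_{k+1}² ≤ t_k² + t_{k+1} for all k ≥ 1. Suppose either (Option 1) λ̂_{k+1} = λ_{k+1} with β ≤ t_1²/L_{g2} and t_{k+1}² ≤ t_k² + (β·μ_g/(1 + β·γ·‖B‖²))·t_k for all k ≥ 1, or (Option 2) λ̂_{k+1} = λ̄_{k+1} with β ≤ t_1²/(L_{g2} + t_1²·γ·‖B‖²) and t_{k+1}² ≤ t_k² + β·μ_g·t_k for all k ≥ 1. Then there exists C > 0 such that for all k ≥ 1: 𝓛(x_k, y_k, λ*) − 𝓛(x*, y*, λ*) ≤ C/t_k², ‖A x_k + B y_k − b‖ ≤ C/t_k², and |f(x_k) + g(y_k) − f(x*) − g(y*)| ≤ C/t_k². -/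

import Mathlib

set_option autoImplicit false

open RealInnerProductSpace

/-- The Lagrangian `𝓛(x,y,λ) = f1 x + f2 x + g1 y + g2 y + ⟪λ, Ax + By − b⟫`. -/
noncomputable def Lagr {m n p : ℕ}
    (f1 f2 : EuclideanSpace ℝ (Fin m) → ℝ)
    (g1 g2 : EuclideanSpace ℝ (Fin n) → ℝ)
    (A : EuclideanSpace ℝ (Fin m) →L[ℝ] EuclideanSpace ℝ (Fin p))
    (B : EuclideanSpace ℝ (Fin n) →L[ℝ] EuclideanSpace ℝ (Fin p))
    (b : EuclideanSpace ℝ (Fin p))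
    (x : EuclideanSpace ℝ (Fin m)) (y : EuclideanSpace ℝ (Fin n))
    (l : EuclideanSpace ℝ (Fin p)) : ℝ :=
  f1 x + f2 x + g1 y + g2 y + ⟪l, A x + B y - b⟫

section SmoothConvex

variable {E : Type*} [NormedAddCommGroup E] [InnerProductSpace ℝ E]

/-- A subgradient of a strongly convex function satisfies the quadratically improved
subgradient inequality. -/
lemma StrongConvexOn.add_inner_add_sq_le {g : E → ℝ} {μ : ℝ}
    (hg : StrongConvexOn Set.univ μ g) {p ζ : E} (hζ : ∀ z, g p + ⟪ζ, z - p⟫ ≤ g z) (z : E) :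
    g p + ⟪ζ, z - p⟫ + μ / 2 * ‖z - p‖ ^ 2 ≤ g z := by
  have key : ∀ s ∈ Set.Ioo (0 : ℝ) 1,
      g p + ⟪ζ, z - p⟫ + (1 - s) * (μ / 2 * ‖z - p‖ ^ 2) ≤ g z := by
    rintro s ⟨hs0, hs1⟩
    have h1 := hg.2 (Set.mem_univ z) (Set.mem_univ p) hs0.le (by linarith : 0 ≤ 1 - s) (by ring)
    have h2 := hζ (s • z + (1 - s) • p)
    have h3 : s • z + (1 - s) • p - p = s • (z - p) := by module
    rw [h3, inner_smul_right] at h2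
    simp only [smul_eq_mul] at h1
    have h4 : s * (g p + ⟪ζ, z - p⟫ + (1 - s) * (μ / 2 * ‖z - p‖ ^ 2)) ≤ s * g z := by
      linarith
    exact le_of_mul_le_mul_left h4 hs0
  have hlim : Filter.Tendsto
      (fun s : ℝ => g p + ⟪ζ, z - p⟫ + (1 - s) * (μ / 2 * ‖z - p‖ ^ 2))
      (nhdsWithin 0 (Set.Ioi 0)) (nhds (g p + ⟪ζ, z - p⟫ + μ / 2 * ‖z - p‖ ^ 2)) := by
    have hc : Continuous
        (fun s : ℝ => g p + ⟪ζ, z - p⟫ + (1 - s) * (μ / 2 * ‖z - p‖ ^ 2)) := by fun_prop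
    simpa using (hc.tendsto 0).mono_left nhdsWithin_le_nhds
  refine le_of_tendsto hlim ?_
  filter_upwards [Ioo_mem_nhdsGT (zero_lt_one' ℝ)] with s hs using key s hs

/-- One accelerated step with a subgradient taken at the averaged point. -/
lemma subgradient_step_averaged {f : E → ℝ} {T : ℝ} (hT : 1 ≤ T) {x x' u' ξ : E}
    (hx' : x' = (1 / T) • u' + ((T - 1) / T) • x)
    (hξ : ∀ z, f x' + ⟪ξ, z - x'⟫ ≤ f z) (z : E) :
    T ^ 2 * (f x' - f z) - (T ^ 2 - T) * (f x - f z) ≤ T * ⟪ξ, u' - z⟫ := by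
  have hT0 : 0 < T := by linarith
  have e : T * ⟪ξ, u' - z⟫ + T * ⟪ξ, z - x'⟫ + (T ^ 2 - T) * ⟪ξ, x - x'⟫ = 0 := by
    simp only [← inner_smul_right, ← inner_add_right]
    rw [show T • (u' - z) + T • (z - x') + (T ^ 2 - T) • (x - x') = 0 by
      rw [hx']
      match_scalars <;> field_simp <;> ring, inner_zero_right]
  have h2 := mul_le_mul_of_nonneg_left (hξ z) hT0.le
  have h3 := mul_le_mul_of_nonneg_left (hξ x) (by nlinarith : 0 ≤ T ^ 2 - T)
  linear_combination h2 + h3 - e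

/-- One accelerated step with a subgradient of a strongly convex function taken at the
extrapolated point. -/
lemma subgradient_step_strongConvex {g : E → ℝ} {μ T : ℝ} (hμ : 0 < μ)
    (hg : StrongConvexOn Set.univ μ g) (hT : 1 ≤ T) {y y' v' ζ : E}
    (hy' : y' = (1 / T) • v' + ((T - 1) / T) • y)
    (hζ : ∀ z, g v' + ⟪ζ, z - v'⟫ ≤ g z) (z : E) :
    T ^ 2 * (g y' - g z) - (T ^ 2 - T) * (g y - g z) ≤
      T * ⟪ζ, v' - z⟫ - T * (μ / 2 * ‖v' - z‖ ^ 2) := by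
  have hT0 : 0 < T := by linarith
  have h1 := (hg.strictConvexOn hμ).convexOn.2 (Set.mem_univ v') (Set.mem_univ y)
    (by positivity : 0 ≤ 1 / T) (div_nonneg (by linarith) hT0.le : 0 ≤ (T - 1) / T)
    (by field_simp; ring)
  rw [← hy'] at h1
  have h1' := mul_le_mul_of_nonneg_left h1 (sq_nonneg T)
  have e1 : T ^ 2 * ((1 / T) • g v' + ((T - 1) / T) • g y) = T * g v' + (T ^ 2 - T) * g y := by
    simp only [smul_eq_mul]
    field_simp
  have h2 := mul_le_mul_of_nonneg_left (hg.add_inner_add_sq_le hζ z) hT0.le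
  rw [← neg_sub v' z, inner_neg_right, norm_neg] at h2
  linear_combination h1' + e1 + h2

lemma inner_sub_sub_self_eq (a b c : E) :
    ⟪a - b, a - c⟫ = (‖a - c‖ ^ 2 + ‖a - b‖ ^ 2 - ‖b - c‖ ^ 2) / 2 := by
  have h : b - c = (a - c) - (a - b) := by abel
  rw [h, norm_sub_sq_real (a - c) (a - b), real_inner_comm]
  ring

/-- The extrapolated point is the average of the momentum variable and the current iterate. -/
lemma extrapolation_eq_average {t : ℕ → ℝ} (ht : ∀ k ≥ 1, 1 ≤ t k) {x u xbar : ℕ → E}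
    (hx0 : x 0 = x 1) (hu1 : u 1 = x 1)
    (hxbar : ∀ k ≥ 1, xbar k = x k + ((t k - 1) / t (k + 1)) • (x k - x (k - 1)))
    (hxupd : ∀ k ≥ 1, x (k + 1) =
      (1 / t (k + 1)) • u (k + 1) + ((t (k + 1) - 1) / t (k + 1)) • x k) :
    ∀ k ≥ 1, xbar k = (1 / t (k + 1)) • u k + ((t (k + 1) - 1) / t (k + 1)) • x k := by
  have hu : ∀ k ≥ 1, u k = x k + (t k - 1) • (x k - x (k - 1)) := by
    intro k hk
    obtain rfl | hk1 := hk.eq_or_lt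
    · simp [hx0, hu1]
    · obtain ⟨j, rfl⟩ : ∃ j, k = j + 1 := ⟨k - 1, by omega⟩
      have hT : 0 < t (j + 1) := by linarith [ht (j + 1) hk]
      rw [Nat.add_sub_cancel, hxupd j (by omega)]
      match_scalars <;> field_simp <;> ring
  intro k hk
  have hT : 0 < t (k + 1) := by linarith [ht (k + 1) (by omega)]
  rw [hxbar k hk, hu k hk]
  match_scalars <;> field_simp
  ring

variable [CompleteSpace E]

lemma HasGradientAt.hasDerivAt_comp_line {f : E → ℝ} {f' : E → E}
    (hf : ∀ x, HasGradientAt f (f' x) x) (p d : E) (s : ℝ) :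
    HasDerivAt (fun s : ℝ => f (p + s • d)) ⟪f' (p + s • d), d⟫ s := by
  have h1 : HasDerivAt (fun s : ℝ => p + s • d) d s := by
    simpa using ((hasDerivAt_id s).smul_const d).const_add p
  exact ((hf (p + s • d)).hasFDerivAt.comp_hasDerivAt s h1).congr_deriv (by simp)

/-- The gradient inequality for differentiable convex functions. -/
lemma ConvexOn.add_inner_gradient_le {f : E → ℝ} {f' : E → E} (hconv : ConvexOn ℝ Set.univ f)
    (hf : ∀ x, HasGradientAt f (f' x) x) (p z : E) : f p + ⟪f' p, z - p⟫ ≤ f z := by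
  have hline : ConvexOn ℝ Set.univ (fun s : ℝ => f (p + s • (z - p))) := by
    refine ⟨convex_univ, fun a _ c _ r s hr hs hrs => ?_⟩
    have h := hconv.2 (Set.mem_univ (p + a • (z - p))) (Set.mem_univ (p + c • (z - p))) hr hs hrs
    convert h using 2
    obtain rfl : s = 1 - r := by linarith
    simp only [smul_eq_mul]
    module
  have h := hline.le_slope_of_hasDerivAt (Set.mem_univ 0) (Set.mem_univ 1) one_pos
    (HasGradientAt.hasDerivAt_comp_line hf p (z - p) 0)
  simp [slope_def_field] at h
  linarith

/-- The descent lemma for functions with Lipschitz continuous gradient. -/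
lemma le_add_inner_gradient_add_sq {f : E → ℝ} {f' : E → E} {L : ℝ}
    (hf : ∀ x, HasGradientAt f (f' x) x) (hlip : ∀ x y, ‖f' x - f' y‖ ≤ L * ‖x - y‖) (p z : E) :
    f z ≤ f p + ⟪f' p, z - p⟫ + L / 2 * ‖z - p‖ ^ 2 := by
  have hd := HasGradientAt.hasDerivAt_comp_line hf p (z - p)
  have hB : ∀ s : ℝ, HasDerivAt
      (fun s : ℝ => f p + s * ⟪f' p, z - p⟫ + L / 2 * ‖z - p‖ ^ 2 * s ^ 2)
      (⟪f' p, z - p⟫ + L * ‖z - p‖ ^ 2 * s) s := by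
    intro s
    refine ((((hasDerivAt_id s).mul_const ⟪f' p, z - p⟫).const_add (f p)).add
      (((hasDerivAt_id s).pow 2).const_mul (L / 2 * ‖z - p‖ ^ 2))).congr_deriv ?_
    simp
    ring
  have h := image_le_of_deriv_right_le_deriv_boundary (a := 0) (b := 1)
    (fun s _ => (hd s).continuousAt.continuousWithinAt)
    (fun s _ => (hd s).hasDerivWithinAt) (by simp)
    (fun s _ => (hB s).continuousAt.continuousWithinAt)
    (fun s _ => (hB s).hasDerivWithinAt) (fun s hs => by
      have h1 : ⟪f' (p + s • (z - p)) - f' p, z - p⟫ ≤ L * ‖s • (z - p)‖ * ‖z - p‖ := by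
        refine (real_inner_le_norm _ _).trans ?_
        gcongr
        simpa using hlip (p + s • (z - p)) p
      rw [norm_smul, Real.norm_of_nonneg hs.1, inner_sub_left] at h1
      linarith) (Set.right_mem_Icc.2 zero_le_one)
  simpa using h

/-- One accelerated step on a smooth convex function. -/
lemma smooth_accelerated_step {f : E → ℝ} {f' : E → E} {L T : ℝ}
    (hconv : ConvexOn ℝ Set.univ f) (hf : ∀ x, HasGradientAt f (f' x) x)
    (hlip : ∀ x y, ‖f' x - f' y‖ ≤ L * ‖x - y‖) (hT : 1 ≤ T) {x x' u u' w : E}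
    (hx' : x' = (1 / T) • u' + ((T - 1) / T) • x) (hw : w = (1 / T) • u + ((T - 1) / T) • x)
    (z : E) :
    T ^ 2 * (f x' - f z) - (T ^ 2 - T) * (f x - f z) ≤
      T * ⟪f' w, u' - z⟫ + L / 2 * ‖u' - u‖ ^ 2 := by
  have hT0 : 0 < T := by linarith
  have h1 := le_add_inner_gradient_add_sq hf hlip w x'
  have h2 := hconv.add_inner_gradient_le hf w z
  have h3 := hconv.add_inner_gradient_le hf w x
  have e1 : T • (x' - w) = u' - u := by
    rw [hx', hw]
    match_scalars <;> field_simp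
    ring
  have e2 : T ^ 2 * ‖x' - w‖ ^ 2 = ‖u' - u‖ ^ 2 := by
    rw [← e1, norm_smul, Real.norm_of_nonneg hT0.le]
    ring
  have e3 : T ^ 2 * ⟪f' w, x' - w⟫ = T * ⟪f' w, u' - z⟫ + T * ⟪f' w, z - w⟫
      + (T ^ 2 - T) * ⟪f' w, x - w⟫ := by
    simp only [← inner_smul_right, ← inner_add_right]
    congr 1
    rw [hx', hw]
    match_scalars <;> field_simp <;> ring
  have h2' := mul_le_mul_of_nonneg_left h2 hT0.le
  have h3' := mul_le_mul_of_nonneg_left h3 (by nlinarith : 0 ≤ T ^ 2 - T)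
  have h1' := mul_le_mul_of_nonneg_left h1 (sq_nonneg T)
  linear_combination h1' + h2' + h3' + e3 + L / 2 * e2

/-- One proximal-gradient step of the accelerated scheme, with the dual term isolated. -/
lemma accelerated_primal_step {F : Type*} [NormedAddCommGroup F] [InnerProductSpace ℝ F]
    [CompleteSpace F] (A : E →L[ℝ] F) {f₁ f₂ : E → ℝ} {f₂' : E → E} {L α T : ℝ}
    (hα : 0 < α) (hαL : α * L ≤ 1) (hconv : ConvexOn ℝ Set.univ f₂)
    (hf : ∀ x, HasGradientAt f₂ (f₂' x) x)
    (hlip : ∀ x y, ‖f₂' x - f₂' y‖ ≤ L * ‖x - y‖) (hT : 1 ≤ T) {x x' u u' w ξ : E} {l : F}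
    (hx' : x' = (1 / T) • u' + ((T - 1) / T) • x) (hw : w = (1 / T) • u + ((T - 1) / T) • x)
    (hξ : ∀ z, f₁ x' + ⟪ξ, z - x'⟫ ≤ f₁ z)
    (hu : u' - u = -((α * T) • (ξ + f₂' w + ContinuousLinearMap.adjoint A l))) (z : E) :
    T ^ 2 * (f₁ x' + f₂ x' - (f₁ z + f₂ z)) - (T ^ 2 - T) * (f₁ x + f₂ x - (f₁ z + f₂ z))
      + 1 / (2 * α) * ‖u' - z‖ ^ 2 ≤ 1 / (2 * α) * ‖u - z‖ ^ 2 - T * ⟪l, A (u' - z)⟫ := by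
  have h1 := smooth_accelerated_step hconv hf hlip hT hx' hw z
  have h2 := subgradient_step_averaged hT hx' hξ z
  have h3 := inner_sub_sub_self_eq u' u z
  have h4 : ⟪u' - u, u' - z⟫ =
      -(α * T * (⟪ξ, u' - z⟫ + ⟪f₂' w, u' - z⟫ + ⟪l, A (u' - z)⟫)) := by
    rw [hu, inner_neg_left, real_inner_smul_left, inner_add_left, inner_add_left,
      ContinuousLinearMap.adjoint_inner_left]
  have h5 : T * ⟪ξ, u' - z⟫ + T * ⟪f₂' w, u' - z⟫ + T * ⟪l, A (u' - z)⟫ =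
      -(1 / (2 * α) * (‖u' - z‖ ^ 2 + ‖u' - u‖ ^ 2 - ‖u - z‖ ^ 2)) := by
    rw [h4] at h3
    field_simp
    linarith
  have h6 : L / 2 * ‖u' - u‖ ^ 2 ≤ 1 / (2 * α) * ‖u' - u‖ ^ 2 := by
    refine mul_le_mul_of_nonneg_right ?_ (sq_nonneg _)
    rw [div_le_div_iff₀ two_pos (by positivity)]
    linarith
  linarith

/-- One step of the strongly convex block, with the dual term isolated. -/
lemma accelerated_primal_step_strongConvex {F : Type*} [NormedAddCommGroup F]
    [InnerProductSpace ℝ F] [CompleteSpace F] (B : E →L[ℝ] F) {g₁ g₂ : E → ℝ} {g₂' : E → E}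
    {L μ β T : ℝ} (hβ : 0 < β) (hμ : 0 < μ) (hg : StrongConvexOn Set.univ μ g₁)
    (hconv : ConvexOn ℝ Set.univ g₂) (hgrad : ∀ y, HasGradientAt g₂ (g₂' y) y)
    (hlip : ∀ x y, ‖g₂' x - g₂' y‖ ≤ L * ‖x - y‖) (hT : 1 ≤ T) {y y' v v' w ζ : E} {l : F}
    (hy' : y' = (1 / T) • v' + ((T - 1) / T) • y) (hw : w = (1 / T) • v + ((T - 1) / T) • y)
    (hζ : ∀ z, g₁ v' + ⟪ζ, z - v'⟫ ≤ g₁ z)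
    (hv : v' - v = -((β / T) • (ζ + g₂' w + ContinuousLinearMap.adjoint B l))) (z : E) :
    T ^ 2 * (g₁ y' + g₂ y' - (g₁ z + g₂ z)) - (T ^ 2 - T) * (g₁ y + g₂ y - (g₁ z + g₂ z))
      + T ^ 2 * (1 / (2 * β) * ‖v' - z‖ ^ 2) + T * (μ / 2 * ‖v' - z‖ ^ 2)
      + (T ^ 2 / β - L) / 2 * ‖v' - v‖ ^ 2 ≤
    T ^ 2 * (1 / (2 * β) * ‖v - z‖ ^ 2) - T * ⟪l, B (v' - z)⟫ := by
  have hT0 : 0 < T := by linarith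
  have h1 := smooth_accelerated_step hconv hgrad hlip hT hy' hw z
  have h2 := subgradient_step_strongConvex hμ hg hT hy' hζ z
  have h3 := inner_sub_sub_self_eq v' v z
  have h4 : ⟪v' - v, v' - z⟫ =
      -(β / T * (⟪ζ, v' - z⟫ + ⟪g₂' w, v' - z⟫ + ⟪l, B (v' - z)⟫)) := by
    rw [hv, inner_neg_left, real_inner_smul_left, inner_add_left, inner_add_left,
      ContinuousLinearMap.adjoint_inner_left]
  have h5 : T * ⟪ζ, v' - z⟫ + T * ⟪g₂' w, v' - z⟫ + T * ⟪l, B (v' - z)⟫ =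
      -(T ^ 2 / β / 2 * (‖v' - z‖ ^ 2 + ‖v' - v‖ ^ 2 - ‖v - z‖ ^ 2)) := by
    rw [h4] at h3
    field_simp at h3 ⊢
    linarith
  have h6 : ∀ r : ℝ, T ^ 2 * (1 / (2 * β) * r) = T ^ 2 / β / 2 * r := fun r => by
    field_simp
  rw [h6, h6]
  linarith

end SmoothConvex

section Multiplier

variable {E : Type*} [NormedAddCommGroup E] [InnerProductSpace ℝ E]

lemma multiplier_step_implicit {γ T : ℝ} (hγ : 0 < γ) (l ls P Q Q₀ : E) :
    T * ⟪ls, P + Q⟫ - T * ⟪l + (γ * T) • (P + Q₀), P⟫ - T * ⟪l + (γ * T) • (P + Q), Q⟫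
      + 1 / (2 * γ) * ‖l + (γ * T) • (P + Q) - ls‖ ^ 2 + T ^ 2 * (γ / 2 * ‖Q‖ ^ 2) ≤
    1 / (2 * γ) * ‖l - ls‖ ^ 2 + T ^ 2 * (γ / 2 * ‖Q₀‖ ^ 2) := by
  have h : 0 ≤ γ * T ^ 2 / 2 * ‖P + Q₀‖ ^ 2 := by positivity
  refine le_of_sub_nonneg (h.trans_eq ?_)
  rw [show l + (γ * T) • (P + Q) - ls = (l - ls) + (γ * T) • (P + Q) by abel]
  simp only [← real_inner_self_eq_norm_sq, inner_add_left, inner_add_right, inner_sub_left,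
    inner_sub_right, real_inner_smul_left, real_inner_smul_right]
  rw [real_inner_comm P Q, real_inner_comm P Q₀, real_inner_comm l P, real_inner_comm l Q,
    real_inner_comm ls P, real_inner_comm ls Q, real_inner_comm l ls]
  field_simp
  ring

lemma multiplier_step_explicit {γ T : ℝ} (hγ : 0 < γ) (l ls P Q Q₀ : E) :
    T * ⟪ls, P + Q⟫ - T * ⟪l + (γ * T) • (P + Q₀), P⟫ - T * ⟪l + (γ * T) • (P + Q₀), Q⟫
      + 1 / (2 * γ) * ‖l + (γ * T) • (P + Q) - ls‖ ^ 2 ≤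
    1 / (2 * γ) * ‖l - ls‖ ^ 2 + T ^ 2 * (γ / 2 * ‖Q - Q₀‖ ^ 2) := by
  have h : 0 ≤ γ * T ^ 2 / 2 * ‖P + Q₀‖ ^ 2 := by positivity
  refine le_of_sub_nonneg (h.trans_eq ?_)
  rw [show l + (γ * T) • (P + Q) - ls = (l - ls) + (γ * T) • (P + Q) by abel]
  simp only [← real_inner_self_eq_norm_sq, inner_add_left, inner_add_right, inner_sub_left,
    inner_sub_right, real_inner_smul_left, real_inner_smul_right]
  rw [real_inner_comm P Q, real_inner_comm P Q₀, real_inner_comm Q Q₀, real_inner_comm l P,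
    real_inner_comm l Q, real_inner_comm ls P, real_inner_comm ls Q, real_inner_comm l ls]
  field_simp
  ring

/-- If the multipliers driven by a weighted residual sequence stay bounded, then the residuals
are `O(1 / t ^ 2)`. -/
lemma exists_sq_mul_norm_le_of_bounded_multiplier {γ M : ℝ} (hγ : 0 < γ) {t : ℕ → ℝ}
    (ht : ∀ k ≥ 1, 1 ≤ t k) (htrec : ∀ k ≥ 1, t (k + 1) ^ 2 ≤ t k ^ 2 + t (k + 1))
    {l s : ℕ → E} {ls : E} (hl : ∀ k ≥ 1, ‖l k - ls‖ ≤ M)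
    (hs : ∀ k ≥ 1, l (k + 1) = l k +
      γ • (t (k + 1) ^ 2 • s (k + 1) - (t (k + 1) ^ 2 - t (k + 1)) • s k)) :
    ∃ K, ∀ k ≥ 1, t k ^ 2 * ‖s k‖ ≤ K := by
  set M' := max M ‖l 1 - ls - (γ * t 1 ^ 2) • s 1‖
  have hD : ∀ k ≥ 1, ‖l k - ls - (γ * t k ^ 2) • s k‖ ≤ M' := by
    intro k hk
    induction k, hk using Nat.le_induction with
    | base => exact le_max_right _ _
    | succ k hk ih =>
      have htk : 0 < t k ^ 2 := by have := ht k hk; positivity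
      set θ := (t (k + 1) ^ 2 - t (k + 1)) / t k ^ 2 with hθ
      have hθ0 : 0 ≤ θ := div_nonneg (by nlinarith [ht (k + 1) (by omega)]) htk.le
      have hθ1 : θ ≤ 1 := (div_le_one htk).2 (by linarith [htrec k hk])
      have hθt : θ * t k ^ 2 = t (k + 1) ^ 2 - t (k + 1) := div_mul_cancel₀ _ htk.ne'
      have e : l (k + 1) - ls - (γ * t (k + 1) ^ 2) • s (k + 1) =
          (1 - θ) • (l k - ls) + θ • (l k - ls - (γ * t k ^ 2) • s k) := by
        rw [hs k hk, ← hθt]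
        module
      rw [e]
      calc _ ≤ (1 - θ) * ‖l k - ls‖ + θ * ‖l k - ls - (γ * t k ^ 2) • s k‖ := by
            refine (norm_add_le _ _).trans_eq ?_
            rw [norm_smul, norm_smul, Real.norm_of_nonneg hθ0,
              Real.norm_of_nonneg (by linarith : 0 ≤ 1 - θ)]
        _ ≤ (1 - θ) * M' + θ * M' := by
            gcongr
            exact (hl k hk).trans (le_max_left _ _)
        _ = M' := by ring
  refine ⟨(M + M') / γ, fun k hk => ?_⟩
  rw [le_div_iff₀ hγ]
  have h : (γ * t k ^ 2) • s k = (l k - ls) - (l k - ls - (γ * t k ^ 2) • s k) := by abel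
  have h2 : ‖(γ * t k ^ 2) • s k‖ ≤ M + M' := by
    rw [h]
    exact (norm_sub_le _ _).trans (add_le_add (hl k hk) (hD k hk))
  rw [norm_smul, Real.norm_of_nonneg (by positivity)] at h2
  linarith

end Multiplier

set_option maxHeartbeats 2000000 in
/-- Convergence of the hybrid accelerated linearized ADMM (Algorithm 6 of Section 4,
Theorem 4.2): `x`-update as in Scheme B, `y`-update as in Scheme A, with either
Option 1 (`λ̂ = λ`) or Option 2 (`λ̂ = λ̄`). -/
theorem stmt18 {m n p : ℕ}
    (A : EuclideanSpace ℝ (Fin m) →L[ℝ] EuclideanSpace ℝ (Fin p))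
    (B : EuclideanSpace ℝ (Fin n) →L[ℝ] EuclideanSpace ℝ (Fin p))
    (b : EuclideanSpace ℝ (Fin p))
    (f1 f2 : EuclideanSpace ℝ (Fin m) → ℝ)
    (g1 g2 : EuclideanSpace ℝ (Fin n) → ℝ)
    (f2' : EuclideanSpace ℝ (Fin m) → EuclideanSpace ℝ (Fin m))
    (g2' : EuclideanSpace ℝ (Fin n) → EuclideanSpace ℝ (Fin n))
    (Lf2 Lg2 μ : ℝ) (hLf2 : 0 ≤ Lf2) (hLg2 : 0 ≤ Lg2) (hμ : 0 < μ)
    -- Assumption 1.1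
    (hf1lsc : LowerSemicontinuous f1) (hf1conv : ConvexOn ℝ Set.univ f1)
    (hf2conv : ConvexOn ℝ Set.univ f2)
    (hf2grad : ∀ x, HasGradientAt f2 (f2' x) x)
    (hf2lip : ∀ x y, ‖f2' x - f2' y‖ ≤ Lf2 * ‖x - y‖)
    (hg1lsc : LowerSemicontinuous g1) (hg1sc : StrongConvexOn Set.univ μ g1)
    (hg2conv : ConvexOn ℝ Set.univ g2)
    (hg2grad : ∀ y, HasGradientAt g2 (g2' y) y)
    (hg2lip : ∀ x y, ‖g2' x - g2' y‖ ≤ Lg2 * ‖x - y‖)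
    -- parameters
    (α β γ : ℝ) (hα : 0 < α) (hβ : 0 < β) (hγ : 0 < γ)
    (t : ℕ → ℝ) (ht1 : ∀ k ≥ 1, 1 ≤ t k) (htmono : ∀ k ≥ 1, t k ≤ t (k + 1))
    (htrec : ∀ k ≥ 1, t (k + 1) ^ 2 ≤ t k ^ 2 + t (k + 1))
    (hαle : α ≤ 1 / Lf2)
    -- iterates of Scheme D (hybrid)
    (x u xbar : ℕ → EuclideanSpace ℝ (Fin m))
    (y v ybar : ℕ → EuclideanSpace ℝ (Fin n))
    (lam lambar lamhat : ℕ → EuclideanSpace ℝ (Fin p))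
    (ξ : ℕ → EuclideanSpace ℝ (Fin m)) (ζ : ℕ → EuclideanSpace ℝ (Fin n))
    (hx0 : x 0 = x 1) (hy0 : y 0 = y 1) (hu1 : u 1 = x 1) (hv1 : v 1 = y 1)
    (hxbar : ∀ k ≥ 1, xbar k = x k + ((t k - 1) / t (k + 1)) • (x k - x (k - 1)))
    (hybar : ∀ k ≥ 1, ybar k = y k + ((t k - 1) / t (k + 1)) • (y k - y (k - 1)))
    (hξ : ∀ k ≥ 1, ∀ z, f1 (x (k + 1)) + ⟪ξ (k + 1), z - x (k + 1)⟫ ≤ f1 z)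
    (hu : ∀ k ≥ 1, u (k + 1) - u k =
      -((α * t (k + 1)) • (ξ (k + 1) + f2' (xbar k) +
        ContinuousLinearMap.adjoint A (lambar (k + 1)))))
    (hζ : ∀ k ≥ 1, ∀ z, g1 (v (k + 1)) + ⟪ζ (k + 1), z - v (k + 1)⟫ ≤ g1 z)
    (hv : ∀ k ≥ 1, v (k + 1) - v k =
      -((β / t (k + 1)) • (ζ (k + 1) + g2' (ybar k) +
        ContinuousLinearMap.adjoint B (lamhat (k + 1)))))
    (hxupd : ∀ k ≥ 1, x (k + 1) =
      (1 / t (k + 1)) • u (k + 1) + ((t (k + 1) - 1) / t (k + 1)) • x k)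
    (hyupd : ∀ k ≥ 1, y (k + 1) =
      (1 / t (k + 1)) • v (k + 1) + ((t (k + 1) - 1) / t (k + 1)) • y k)
    (hlam : ∀ k ≥ 1, lam (k + 1) =
      lam k + (γ * t (k + 1)) • (A (u (k + 1)) + B (v (k + 1)) - b))
    (hlambar : ∀ k ≥ 1, lambar (k + 1) =
      lam k + (γ * t (k + 1)) • (A (u (k + 1)) + B (v k) - b))
    (hopt :
      ((∀ k ≥ 1, lamhat (k + 1) = lam (k + 1)) ∧ β ≤ t 1 ^ 2 / Lg2 ∧
        ∀ k ≥ 1, t (k + 1) ^ 2 ≤ t k ^ 2 + β * μ / (1 + β * γ * ‖B‖ ^ 2) * t k) ∨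
      ((∀ k ≥ 1, lamhat (k + 1) = lambar (k + 1)) ∧
        β ≤ t 1 ^ 2 / (Lg2 + t 1 ^ 2 * γ * ‖B‖ ^ 2) ∧
        ∀ k ≥ 1, t (k + 1) ^ 2 ≤ t k ^ 2 + β * μ * t k))
    -- saddle point
    (xs : EuclideanSpace ℝ (Fin m)) (ys : EuclideanSpace ℝ (Fin n))
    (lams : EuclideanSpace ℝ (Fin p))
    (hsaddle : ∀ xx yy ll,
      Lagr f1 f2 g1 g2 A B b xs ys ll ≤ Lagr f1 f2 g1 g2 A B b xs ys lams ∧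
      Lagr f1 f2 g1 g2 A B b xs ys lams ≤ Lagr f1 f2 g1 g2 A B b xx yy lams) :
    -- conclusion
    ∃ C > 0, ∀ k ≥ 1,
      Lagr f1 f2 g1 g2 A B b (x k) (y k) lams -
          Lagr f1 f2 g1 g2 A B b xs ys lams ≤ C / t k ^ 2 ∧
      ‖A (x k) + B (y k) - b‖ ≤ C / t k ^ 2 ∧
      |f1 (x k) + f2 (x k) + g1 (y k) + g2 (y k) -
          (f1 xs + f2 xs + g1 ys + g2 ys)| ≤ C / t k ^ 2 := by
  have hmono1 : ∀ k ≥ 1, t 1 ≤ t k := by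
    intro k hk
    induction k, hk using Nat.le_induction with
    | base => exact le_rfl
    | succ k hk ih => exact ih.trans (htmono k hk)
  have hxs : ∀ k ≥ 1, xbar k = (1 / t (k + 1)) • u k + ((t (k + 1) - 1) / t (k + 1)) • x k :=
    extrapolation_eq_average ht1 hx0 hu1 hxbar hxupd
  have hys : ∀ k ≥ 1, ybar k = (1 / t (k + 1)) • v k + ((t (k + 1) - 1) / t (k + 1)) • y k :=
    extrapolation_eq_average ht1 hy0 hv1 hybar hyupd
  have hfeas : A xs + B ys - b = 0 := by
    have h := (hsaddle xs ys (lams + (A xs + B ys - b))).1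
    simp only [Lagr, inner_add_left, add_le_add_iff_left] at h
    rw [real_inner_self_eq_norm_sq] at h
    exact norm_eq_zero.1 (pow_eq_zero_iff two_ne_zero |>.1
      (le_antisymm (by linarith) (sq_nonneg _)))
  have hαL : α * Lf2 ≤ 1 := by
    have hL : 0 < Lf2 := by
      rcases hLf2.eq_or_lt with h | h
      · rw [← h] at hαle
        simp at hαle
        linarith
      · exact h
    rwa [le_div_iff₀ hL] at hαle
  have hxstep := fun k (hk : k ≥ 1) => accelerated_primal_step A hα hαL hf2conv hf2grad hf2lip
    (ht1 (k + 1) (by omega)) (hxupd k hk) (hxs k hk) (hξ k hk) (hu k hk) xs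
  have hystep := fun k (hk : k ≥ 1) => accelerated_primal_step_strongConvex B hβ hμ hg1sc
    hg2conv hg2grad hg2lip (ht1 (k + 1) (by omega)) (hyupd k hk) (hys k hk) (hζ k hk) (hv k hk) ys
  have hPQ : ∀ k, ∀ w : EuclideanSpace ℝ (Fin n),
      A (u k) + B w - b = A (u k - xs) + B (w - ys) := by
    intro k w
    calc A (u k) + B w - b = A (u k - xs) + B (w - ys) + (A xs + B ys - b) := by
          rw [map_sub, map_sub]
          abel
      _ = A (u k - xs) + B (w - ys) := by rw [hfeas, add_zero]
  obtain ⟨N, hN0, hNstep, hNgrow⟩ : ∃ N : EuclideanSpace ℝ (Fin n) → ℝ, (∀ e, 0 ≤ N e) ∧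
      (∀ k ≥ 1, t (k + 1) ^ 2 * (g1 (y (k + 1)) + g2 (y (k + 1)) - (g1 ys + g2 ys))
          - (t (k + 1) ^ 2 - t (k + 1)) * (g1 (y k) + g2 (y k) - (g1 ys + g2 ys))
          + t (k + 1) ^ 2 * N (v (k + 1) - ys)
          + t (k + 1) * (μ / 2 * ‖v (k + 1) - ys‖ ^ 2)
          + t (k + 1) * ⟪lams, A (u (k + 1) - xs) + B (v (k + 1) - ys)⟫
          - t (k + 1) * ⟪lambar (k + 1), A (u (k + 1) - xs)⟫
          + 1 / (2 * γ) * ‖lam (k + 1) - lams‖ ^ 2 ≤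
        t (k + 1) ^ 2 * N (v k - ys) + 1 / (2 * γ) * ‖lam k - lams‖ ^ 2) ∧
      (∀ k ≥ 1, ∀ e, t (k + 1) ^ 2 * N e ≤ t k ^ 2 * N e + t k * (μ / 2 * ‖e‖ ^ 2)) := by
    rcases hopt with ⟨hhat, hβle, hgrow⟩ | ⟨hhat, hβle, hgrow⟩
    · refine ⟨fun e => 1 / (2 * β) * ‖e‖ ^ 2 + γ / 2 * ‖B e‖ ^ 2, fun e => by positivity,
        fun k hk => ?_, fun k hk e => ?_⟩
      · have h1 := hystep k hk
        have h2 := multiplier_step_implicit (T := t (k + 1)) hγ (lam k) lams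
          (A (u (k + 1) - xs)) (B (v (k + 1) - ys)) (B (v k - ys))
        rw [← hPQ, ← hPQ, ← hlam k hk, ← hlambar k hk, hPQ] at h2
        have hL : Lg2 ≤ t (k + 1) ^ 2 / β := by
          rw [le_div_iff₀ hβ, mul_comm]
          have ht : t 1 ^ 2 ≤ t (k + 1) ^ 2 :=
            pow_le_pow_left₀ (by linarith [ht1 1 le_rfl]) (hmono1 _ (by omega)) 2
          refine le_trans ?_ ht
          rcases hLg2.eq_or_lt with h | h
          · rw [← h, mul_zero]
            positivity
          · rwa [le_div_iff₀ h] at hβle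
        have h3 : 0 ≤ (t (k + 1) ^ 2 / β - Lg2) / 2 * ‖v (k + 1) - v k‖ ^ 2 :=
          mul_nonneg (by linarith) (sq_nonneg _)
        rw [hhat k hk] at h1
        linarith
      · set c := β * μ / (1 + β * γ * ‖B‖ ^ 2) with hc
        have hden : 0 < 1 + β * γ * ‖B‖ ^ 2 := by positivity
        have hBe : ‖B e‖ ^ 2 ≤ ‖B‖ ^ 2 * ‖e‖ ^ 2 := by
          rw [← mul_pow]
          exact pow_le_pow_left₀ (norm_nonneg _) (B.le_opNorm e) 2
        have htk : 0 < t k := by linarith [ht1 k hk]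
        have hN : c * (1 / (2 * β) * ‖e‖ ^ 2 + γ / 2 * ‖B e‖ ^ 2) ≤ μ / 2 * ‖e‖ ^ 2 := by
          calc _ ≤ c * (1 / (2 * β) * ‖e‖ ^ 2 + γ / 2 * (‖B‖ ^ 2 * ‖e‖ ^ 2)) := by gcongr
            _ = μ / 2 * ‖e‖ ^ 2 := by
              rw [hc]
              field_simp
        have h1 := mul_le_mul_of_nonneg_right (hgrow k hk)
          (by positivity : 0 ≤ 1 / (2 * β) * ‖e‖ ^ 2 + γ / 2 * ‖B e‖ ^ 2)
        have h2 := mul_le_mul_of_nonneg_left hN htk.le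
        linarith
    · refine ⟨fun e => 1 / (2 * β) * ‖e‖ ^ 2, fun e => by positivity,
        fun k hk => ?_, fun k hk e => ?_⟩
      · have h1 := hystep k hk
        have h2 := multiplier_step_explicit (T := t (k + 1)) hγ (lam k) lams
          (A (u (k + 1) - xs)) (B (v (k + 1) - ys)) (B (v k - ys))
        rw [← map_sub, sub_sub_sub_cancel_right, ← hPQ, ← hPQ, ← hlam k hk, ← hlambar k hk,
          hPQ] at h2
        have hBe : ‖B (v (k + 1) - v k)‖ ^ 2 ≤ ‖B‖ ^ 2 * ‖v (k + 1) - v k‖ ^ 2 := by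
          rw [← mul_pow]
          exact pow_le_pow_left₀ (norm_nonneg _) (B.le_opNorm _) 2
        have hL : Lg2 + t (k + 1) ^ 2 * γ * ‖B‖ ^ 2 ≤ t (k + 1) ^ 2 / β := by
          rw [le_div_iff₀ hβ, mul_comm]
          have ht0 : 0 < t 1 ^ 2 := by have := ht1 1 le_rfl; positivity
          have ht : t 1 ^ 2 ≤ t (k + 1) ^ 2 :=
            pow_le_pow_left₀ (by linarith [ht1 1 le_rfl]) (hmono1 _ (by omega)) 2
          have hden : β * (Lg2 + t 1 ^ 2 * γ * ‖B‖ ^ 2) ≤ t 1 ^ 2 := by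
            rcases (by positivity : 0 ≤ Lg2 + t 1 ^ 2 * γ * ‖B‖ ^ 2).eq_or_lt with h | h
            · rw [← h, mul_zero]
              positivity
            · rwa [le_div_iff₀ h] at hβle
          have hβL : 0 ≤ β * Lg2 := by positivity
          have hfac : 0 ≤ 1 - β * γ * ‖B‖ ^ 2 := by
            by_contra! hneg
            nlinarith
          nlinarith [mul_le_mul_of_nonneg_right ht hfac]
        have h3 := mul_le_mul_of_nonneg_right hL (sq_nonneg ‖v (k + 1) - v k‖)
        have h4 := mul_le_mul_of_nonneg_left hBe (by positivity : 0 ≤ t (k + 1) ^ 2 * γ)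
        rw [hhat k hk] at h1
        rw [inner_add_right lams] at h2 ⊢
        linarith
      · have h := mul_le_mul_of_nonneg_right (hgrow k hk)
          (by positivity : 0 ≤ 1 / (2 * β) * ‖e‖ ^ 2)
        have e1 : β * μ * t k * (1 / (2 * β) * ‖e‖ ^ 2) = t k * (μ / 2 * ‖e‖ ^ 2) := by
          field_simp
        linarith
  set s : ℕ → EuclideanSpace ℝ (Fin p) := fun k => A (x k) + B (y k) - b with hs
  set Fs := f1 xs + f2 xs + g1 ys + g2 ys with hFs
  set gap : ℕ → ℝ := fun k => Lagr f1 f2 g1 g2 A B b (x k) (y k) lams -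
    Lagr f1 f2 g1 g2 A B b xs ys lams with hgap
  have hgap0 : ∀ k, 0 ≤ gap k := fun k => sub_nonneg.2 (hsaddle (x k) (y k) lams).2
  have hgap_eq : ∀ k, gap k =
      f1 (x k) + f2 (x k) + g1 (y k) + g2 (y k) - Fs + ⟪lams, s k⟫ := by
    intro k
    simp only [hgap, Lagr, hfeas, inner_zero_right, hs, hFs]
    ring
  have hresid : ∀ k ≥ 1, t (k + 1) ^ 2 • s (k + 1) - (t (k + 1) ^ 2 - t (k + 1)) • s k =
      t (k + 1) • (A (u (k + 1)) + B (v (k + 1)) - b) := by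
    intro k hk
    have hT : 0 < t (k + 1) := by linarith [ht1 (k + 1) (by omega)]
    simp only [hs]
    rw [hxupd k hk, hyupd k hk]
    simp only [map_add, map_smul]
    match_scalars <;> field_simp <;> ring
  set E : ℕ → ℝ := fun k => t k ^ 2 * gap k + 1 / (2 * α) * ‖u k - xs‖ ^ 2
    + t (k + 1) ^ 2 * N (v k - ys) + 1 / (2 * γ) * ‖lam k - lams‖ ^ 2 with hE
  have hEstep : ∀ k ≥ 1, E (k + 1) ≤ E k := by
    intro k hk
    have h1 := hxstep k hk
    have h2 := hNstep k hk
    have h3 := hNgrow (k + 1) (by omega) (v (k + 1) - ys)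
    have h4 : t (k + 1) ^ 2 * ⟪lams, s (k + 1)⟫ - (t (k + 1) ^ 2 - t (k + 1)) * ⟪lams, s k⟫ =
        t (k + 1) * ⟪lams, A (u (k + 1) - xs) + B (v (k + 1) - ys)⟫ := by
      rw [← hPQ, ← inner_smul_right, ← inner_smul_right, ← inner_smul_right, ← inner_sub_right,
        hresid k hk]
    have h5 := mul_le_mul_of_nonneg_right (htrec k hk) (hgap0 k)
    simp only [hE]
    have h6 := hgap_eq k
    have h7 := hgap_eq (k + 1)
    have h8 : t (k + 1) ^ 2 * gap (k + 1) - (t (k + 1) ^ 2 - t (k + 1)) * gap k ≤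
        1 / (2 * α) * ‖u k - xs‖ ^ 2 - 1 / (2 * α) * ‖u (k + 1) - xs‖ ^ 2
        + t (k + 1) ^ 2 * N (v k - ys) - t (k + 1) ^ 2 * N (v (k + 1) - ys)
        - t (k + 1) * (μ / 2 * ‖v (k + 1) - ys‖ ^ 2)
        + 1 / (2 * γ) * ‖lam k - lams‖ ^ 2 - 1 / (2 * γ) * ‖lam (k + 1) - lams‖ ^ 2 := by
      rw [h6, h7, hFs]
      linarith
    linarith
  have hEle : ∀ k ≥ 1, E k ≤ E 1 := by
    intro k hk
    induction k, hk using Nat.le_induction with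
    | base => exact le_rfl
    | succ k hk ih => exact (hEstep k hk).trans ih
  have hgap_le : ∀ k ≥ 1, t k ^ 2 * gap k ≤ E 1 := by
    intro k hk
    have h1 : 0 ≤ t (k + 1) ^ 2 * N (v k - ys) := mul_nonneg (sq_nonneg _) (hN0 _)
    have h2 : 0 ≤ 1 / (2 * α) * ‖u k - xs‖ ^ 2 := by positivity
    have h3 : 0 ≤ 1 / (2 * γ) * ‖lam k - lams‖ ^ 2 := by positivity
    have := hEle k hk
    simp only [hE] at this ⊢
    linarith
  have hlam_le : ∀ k ≥ 1, ‖lam k - lams‖ ≤ √(2 * γ * E 1) := by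
    intro k hk
    apply Real.le_sqrt_of_sq_le
    have h1 : 0 ≤ t (k + 1) ^ 2 * N (v k - ys) := mul_nonneg (sq_nonneg _) (hN0 _)
    have h2 : 0 ≤ 1 / (2 * α) * ‖u k - xs‖ ^ 2 := by positivity
    have h3 : 0 ≤ t k ^ 2 * gap k := mul_nonneg (sq_nonneg _) (hgap0 k)
    have h4 : 1 / (2 * γ) * ‖lam k - lams‖ ^ 2 ≤ E 1 := by
      have := hEle k hk
      simp only [hE] at this ⊢
      linarith
    calc ‖lam k - lams‖ ^ 2 = 2 * γ * (1 / (2 * γ) * ‖lam k - lams‖ ^ 2) := by field_simp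
      _ ≤ 2 * γ * E 1 := by gcongr
  obtain ⟨K, hK⟩ := exists_sq_mul_norm_le_of_bounded_multiplier hγ ht1 htrec hlam_le
    (s := s) (fun k hk => by rw [hresid k hk, smul_smul, hlam k hk])
  have hE1 : 0 ≤ E 1 := (mul_nonneg (sq_nonneg _) (hgap0 1)).trans (hgap_le 1 le_rfl)
  have hK0 : 0 ≤ K := le_trans (by positivity) (hK 1 le_rfl)
  have hlK : 0 ≤ ‖lams‖ * K := by positivity
  refine ⟨E 1 + K + ‖lams‖ * K + 1, by positivity, fun k hk => ?_⟩
  have htk : 0 < t k ^ 2 := by have := ht1 k hk; positivity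
  have hg := hgap_le k hk
  have hsk := hK k hk
  simp only [le_div_iff₀ htk]
  refine ⟨?_, ?_, ?_⟩
  · change gap k * t k ^ 2 ≤ _
    linarith
  · change ‖s k‖ * t k ^ 2 ≤ _
    linarith
  · have h1 : f1 (x k) + f2 (x k) + g1 (y k) + g2 (y k) - Fs = gap k - ⟪lams, s k⟫ := by
      rw [hgap_eq]
      ring
    have h2 : |gap k - ⟪lams, s k⟫| ≤ gap k + ‖lams‖ * ‖s k‖ := by
      refine (abs_sub _ _).trans ?_
      rw [abs_of_nonneg (hgap0 k)]
      gcongr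
      exact abs_real_inner_le_norm _ _
    rw [h1]
    have h3 := mul_le_mul_of_nonneg_right h2 htk.le
    have h4 := mul_le_mul_of_nonneg_left hsk (norm_nonneg lams)
    linarith
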